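/- Let x > 0 and set φ(y) := ψ(y) + 1/(2y) − log y for y > 0. Then √x · [ (γ − log(2πx))/(2x) + Σ_{n=1}^∞ φ(nx) ] = (1/√x) · [ (x/2)(γ − log(2π/x)) + Σ_{n=1}^∞ φ(n/x) ], where both series converge absolutely. -/

import Mathlib

open Real Filter Topology Finset

noncomputable def psi (y : ℝ) : ℝ := deriv Real.Gamma y / Real.Gamma y

noncomputable def phiR (y : ℝ) : ℝ := psi y + 1 / (2 * y) - Real.log y

theorem Real.log_add_one_le_of_nonneg {t : ℝ} (ht : 0 ≤ t) :
    log (1 + t) ≤ t * (2 + t) / (2 * (1 + t)) := by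
  have h := Real.self_le_sinh_iff.2 (Real.log_nonneg (by linarith : (1 : ℝ) ≤ 1 + t))
  rw [Real.sinh_log (by linarith)] at h
  refine h.trans_eq ?_
  field_simp
  ring

theorem log_add_sub_log_le {y h : ℝ} (hy : 0 < y) (hh : 0 < h) :
    log (y + h) - log y ≤ h * (2 * y + h) / (2 * y * (y + h)) := by
  have key := Real.log_add_one_le_of_nonneg (div_pos hh hy).le
  rw [← log_div (by positivity) hy.ne', show (y + h) / y = 1 + h / y by field_simp]
  refine key.trans_eq ?_
  field_simp

theorem le_log_add_sub_log {y h : ℝ} (hy : 0 < y) (hh : 0 < h) :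
    2 * h / (2 * y + h) ≤ log (y + h) - log y := by
  have key := Real.le_log_one_add_of_nonneg (div_pos hh hy).le
  rw [← log_div (by positivity) hy.ne', show (y + h) / y = 1 + h / y by field_simp]
  refine Eq.trans_le ?_ key
  field_simp
  ring

theorem hasDerivAt_log_Gamma {y : ℝ} (hy : 0 < y) :
    HasDerivAt (log ∘ Real.Gamma) (psi y) y :=
  (Real.differentiableAt_Gamma fun m => by
    have : (0 : ℝ) ≤ m := m.cast_nonneg
    linarith).hasDerivAt.log (Real.Gamma_pos_of_pos hy).ne'

theorem psi_add_one {y : ℝ} (hy : 0 < y) : psi (y + 1) = psi y + 1 / y := by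
  have h1 : HasDerivAt (fun z => (log ∘ Real.Gamma) (z + 1)) (psi (y + 1)) y :=
    (hasDerivAt_log_Gamma (by linarith : 0 < y + 1)).comp_add_const y 1
  have h2 : HasDerivAt (fun z => log z + (log ∘ Real.Gamma) z) (y⁻¹ + psi y) y :=
    (Real.hasDerivAt_log hy.ne').add (hasDerivAt_log_Gamma hy)
  have h3 : (fun z => (log ∘ Real.Gamma) (z + 1)) =ᶠ[𝓝 y]
      fun z => log z + (log ∘ Real.Gamma) z := by
    filter_upwards [lt_mem_nhds hy] with z hz
    simp only [Function.comp_apply]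
    rw [Real.Gamma_add_one hz.ne', log_mul hz.ne' (Real.Gamma_pos_of_pos hz).ne']
  rw [h1.unique (h2.congr_of_eventuallyEq h3)]
  ring

theorem slope_log_Gamma {y : ℝ} (hy : 0 < y) :
    slope (log ∘ Real.Gamma) y (y + 1) = log y := by
  rw [slope_def_field]
  simp only [Function.comp_apply]
  rw [Real.Gamma_add_one hy.ne', log_mul hy.ne' (Real.Gamma_pos_of_pos hy).ne']
  simp

theorem psi_le_log {y : ℝ} (hy : 0 < y) : psi y ≤ log y := by
  rw [← slope_log_Gamma hy]
  exact Real.convexOn_log_Gamma.le_slope_of_hasDerivAt (Set.mem_Ioi.2 hy)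
    (Set.mem_Ioi.2 (by linarith)) (by linarith) (hasDerivAt_log_Gamma hy)

theorem log_sub_le_psi {y : ℝ} (hy : 0 < y) : log y - 1 / y ≤ psi y := by
  have h : slope (log ∘ Real.Gamma) y (y + 1) ≤ psi (y + 1) :=
    Real.convexOn_log_Gamma.slope_le_of_hasDerivAt (Set.mem_Ioi.2 hy)
      (Set.mem_Ioi.2 (by linarith)) (by linarith) (hasDerivAt_log_Gamma (by linarith))
  rw [slope_log_Gamma hy, psi_add_one hy] at h
  linarith

theorem abs_phiR_le_inv {y : ℝ} (hy : 0 < y) : |phiR y| ≤ 1 / y := by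
  have h1 := psi_le_log hy
  have h2 := log_sub_le_psi hy
  have h3 : 1 / (2 * y) = 1 / y / 2 := by field_simp
  have h4 : 0 < 1 / y := by positivity
  rw [phiR, abs_le]
  constructor <;> linarith

theorem tendsto_phiR_add_natCast {y : ℝ} (hy : 0 < y) :
    Tendsto (fun k : ℕ => phiR (y + k)) atTop (𝓝 0) := by
  have h : Tendsto (fun k : ℕ => 1 / (y + k)) atTop (𝓝 0) :=
    tendsto_const_nhds.div_atTop (tendsto_atTop_add_const_left _ _ tendsto_natCast_atTop_atTop)
  exact squeeze_zero_norm (fun k => abs_phiR_le_inv (by positivity)) h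

theorem phiR_le_phiR_add_one {y : ℝ} (hy : 0 < y) : phiR y ≤ phiR (y + 1) := by
  have h := log_add_sub_log_le hy one_pos
  have e : 1 * (2 * y + 1) / (2 * y * (y + 1)) = 1 / y + 1 / (2 * (y + 1)) - 1 / (2 * y) := by
    field_simp
    ring
  rw [phiR, phiR, psi_add_one hy]
  linarith

theorem phiR_add_one_add_le {y : ℝ} (hy : 0 < y) :
    phiR (y + 1) + 1 / (2 * (y + 1) ^ 2) ≤ phiR y + 1 / (2 * y ^ 2) := by
  have h := le_log_add_sub_log hy one_pos
  have e : 0 ≤ 1 / (2 * y ^ 2) - 1 / (2 * (y + 1) ^ 2) + 2 * 1 / (2 * y + 1)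
      - (1 / y + 1 / (2 * (y + 1)) - 1 / (2 * y)) := by
    have : 1 / (2 * y ^ 2) - 1 / (2 * (y + 1) ^ 2) + 2 * 1 / (2 * y + 1)
      - (1 / y + 1 / (2 * (y + 1)) - 1 / (2 * y))
      = ((2 * y + 1) ^ 2 - y * (y + 1)) / (2 * y ^ 2 * (y + 1) ^ 2 * (2 * y + 1)) := by
      field_simp
      ring
    rw [this]
    apply div_nonneg _ (by positivity)
    nlinarith
  rw [phiR, phiR, psi_add_one hy]
  linarith

theorem abs_phiR_le {y : ℝ} (hy : 0 < y) : |phiR y| ≤ 1 / (2 * y ^ 2) := by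
  have hk : ∀ k : ℕ, 0 < y + k := fun k => by positivity
  have hmono : Monotone fun k : ℕ => phiR (y + k) := monotone_nat_of_le_succ fun k => by
    simpa [add_assoc] using phiR_le_phiR_add_one (hk k)
  have hanti : Antitone fun k : ℕ => phiR (y + k) + 1 / (2 * (y + k) ^ 2) :=
    antitone_nat_of_succ_le fun k => by
      simpa [add_assoc] using phiR_add_one_add_le (hk k)
  have hlim : Tendsto (fun k : ℕ => 1 / (2 * (y + k) ^ 2)) atTop (𝓝 0) :=
    tendsto_const_nhds.div_atTop (((tendsto_pow_atTop two_ne_zero).comp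
      (tendsto_atTop_add_const_left _ _ tendsto_natCast_atTop_atTop)).const_mul_atTop two_pos)
  have h1 := hmono.ge_of_tendsto (tendsto_phiR_add_natCast hy) 0
  have h2 := hanti.le_of_tendsto ((tendsto_phiR_add_natCast hy).add hlim) 0
  simp only [Nat.cast_zero, add_zero] at h1 h2
  rw [abs_le]
  have : 0 < 1 / (2 * y ^ 2) := by positivity
  constructor <;> linarith

theorem summable_phiR_mul {x : ℝ} (hx : 0 < x) :
    Summable fun n : ℕ => phiR ((n + 1 : ℕ) * x) := by
  have h : Summable fun n : ℕ => 1 / (2 * x ^ 2) * (1 / ((n + 1 : ℕ) : ℝ) ^ 2) :=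
    ((summable_nat_add_iff (f := fun n : ℕ => 1 / (n : ℝ) ^ 2) 1).2
      (Real.summable_one_div_nat_pow.2 one_lt_two)).mul_left _
  refine h.of_norm_bounded fun n => ?_
  refine (abs_phiR_le (by positivity)).trans_eq ?_
  field_simp

theorem sum_one_div_add {y : ℝ} (hy : 0 < y) (M : ℕ) :
    ∑ m ∈ range M, 1 / (y + (m + 1 : ℕ)) = psi (y + M) + 1 / (y + M) - (psi y + 1 / y) := by
  induction M with
  | zero => simp
  | succ M ih =>
    have hM : 0 < y + M := by positivity
    rw [sum_range_succ, ih, Nat.cast_succ, ← add_assoc, psi_add_one hM]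
    ring

theorem abs_euler_maclaurin_step_le {x y : ℝ} (hx : 0 < x) (hy : 0 < y) :
    |phiR (y + x) + 1 / (2 * (y + x)) + log (y + x)
      - ((((y + x) * log (y + x) - (y + x)) - (y * log y - y)) / x
        + (1 / 2 + 1 / (2 * x)) * (log (y + x) - log y))|
      ≤ (1 / (2 * x) + x / 4 + 1 / 2) * (1 / y - 1 / (y + x)) := by
  have hphi := abs_phiR_le (by positivity : 0 < y + x)
  have hphi' : 1 / (2 * (y + x) ^ 2) ≤ 1 / (2 * x) * (1 / y - 1 / (y + x)) := by
    have : 1 / (2 * x) * (1 / y - 1 / (y + x)) = 1 / (2 * (y * (y + x))) := by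
      field_simp
      ring
    rw [this]
    apply one_div_le_one_div_of_le (by positivity)
    nlinarith
  set d := log (y + x) - log y with hd
  have hlo := le_log_add_sub_log hy hx
  have hup := log_add_sub_log_le hy hx
  rw [← hd] at hlo hup
  have e1 : phiR (y + x) + 1 / (2 * (y + x)) + log (y + x)
      - ((((y + x) * log (y + x) - (y + x)) - (y * log y - y)) / x + (1 / 2 + 1 / (2 * x)) * d)
      = phiR (y + x) - (((2 * y + x) / (2 * x)) * d - 1) - 1 / 2 * (d / x - 1 / (y + x)) := by
    rw [hd]
    field_simp
    ring
  have h1 : 0 ≤ ((2 * y + x) / (2 * x)) * d - 1 := by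
    have := mul_le_mul_of_nonneg_left hlo (by positivity : 0 ≤ (2 * y + x) / (2 * x))
    have e : (2 * y + x) / (2 * x) * (2 * x / (2 * y + x)) = 1 := by field_simp
    linarith
  have h2 : ((2 * y + x) / (2 * x)) * d - 1 ≤ x / 4 * (1 / y - 1 / (y + x)) := by
    have := mul_le_mul_of_nonneg_left hup (by positivity : 0 ≤ (2 * y + x) / (2 * x))
    have e : (2 * y + x) / (2 * x) * (x * (2 * y + x) / (2 * y * (y + x)))
        = 1 + x / 4 * (1 / y - 1 / (y + x)) := by
      field_simp
      ring
    linarith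
  have h3 : 0 ≤ d / x - 1 / (y + x) := by
    have := div_le_div_of_nonneg_right hlo hx.le
    have e : 1 / (y + x) ≤ 2 * x / (2 * y + x) / x := by
      rw [div_div, div_le_div_iff₀ (by positivity) (by positivity)]
      nlinarith
    linarith
  have h4 : d / x - 1 / (y + x) ≤ 1 / y - 1 / (y + x) := by
    have := div_le_div_of_nonneg_right hup hx.le
    have e : x * (2 * y + x) / (2 * y * (y + x)) / x ≤ 1 / y := by
      rw [div_div, div_le_div_iff₀ (by positivity) (by positivity)]
      nlinarith [mul_pos hx hy, mul_pos (mul_pos hx hy) hx]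
    linarith
  rw [e1, abs_le]
  rw [abs_le] at hphi
  constructor <;> linarith [hphi.1, hphi.2]

/-- The main term of `∑ n ≤ N, (φ (n x) + ∑ m ≤ N, 1 / (n x + m))`. -/
noncomputable def mainTerm (x : ℝ) (N : ℕ) : ℝ :=
  (((N + N * x) * log (N + N * x) - (N + N * x)) - (N * log N - N)) / x
    + (1 / 2 + 1 / (2 * x)) * (log (N + N * x) - log N)
    - harmonic N / (2 * x) - N * log x - log N.factorial

theorem sum_phiR_add_sum_eq {x : ℝ} (hx : 0 < x) (N : ℕ) :
    ∑ n ∈ range N, phiR ((n + 1 : ℕ) * x)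
      + ∑ n ∈ range N, ∑ m ∈ range N, 1 / ((n + 1 : ℕ) * x + (m + 1 : ℕ))
      = ∑ n ∈ range N, (phiR (N + (n + 1 : ℕ) * x) + 1 / (2 * (N + (n + 1 : ℕ) * x))
          + log (N + (n + 1 : ℕ) * x))
        - harmonic N / (2 * x) - N * log x - log N.factorial := by
  have hH : (harmonic N : ℝ) / (2 * x) = ∑ n ∈ range N, 1 / (2 * ((n + 1 : ℕ) * x)) := by
    rw [harmonic, Rat.cast_sum, sum_div]
    refine sum_congr rfl fun n _ => ?_
    push_cast
    field_simp
  have hL : N * log x + log N.factorial = ∑ n ∈ range N, log ((n + 1 : ℕ) * x) := by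
    rw [← prod_range_add_one_eq_factorial, Nat.cast_prod,
      log_prod fun n _ => by positivity]
    have : N * log x = ∑ n ∈ range N, log x := by simp
    rw [this, ← sum_add_distrib]
    refine sum_congr rfl fun n _ => ?_
    rw [log_mul (by positivity) hx.ne', add_comm]
  rw [sub_sub, hL, hH, ← sum_add_distrib, ← sum_sub_distrib, ← sum_sub_distrib]
  refine sum_congr rfl fun n _ => ?_
  have hy : 0 < ((n + 1 : ℕ) : ℝ) * x := by positivity
  rw [sum_one_div_add hy, add_comm (N : ℝ)]
  have hy' : 0 < ((n + 1 : ℕ) : ℝ) * x + N := by positivity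
  generalize ((n + 1 : ℕ) : ℝ) * x = y at *
  rw [phiR, phiR]
  field_simp
  ring

theorem abs_sum_phiR_add_sum_sub_mainTerm_le {x : ℝ} (hx : 0 < x) {N : ℕ} (hN : 0 < N) :
    |∑ n ∈ range N, phiR ((n + 1 : ℕ) * x)
      + ∑ n ∈ range N, ∑ m ∈ range N, 1 / ((n + 1 : ℕ) * x + (m + 1 : ℕ)) - mainTerm x N|
      ≤ (1 / (2 * x) + x / 4 + 1 / 2) / N := by
  have hN' : (0 : ℝ) < N := by exact_mod_cast hN
  set C := 1 / (2 * x) + x / 4 + 1 / 2 with hC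
  have hC0 : 0 < C := by positivity
  let y : ℕ → ℝ := fun n => N + n * x
  let F : ℕ → ℝ := fun n => (y n * log (y n) - y n) / x + (1 / 2 + 1 / (2 * x)) * log (y n)
  have hF := sum_range_sub F N
  have hB := sum_range_sub' (fun n => 1 / y n) N
  have hstep : ∀ n, y (n + 1) = y n + x := fun n => by
    simp only [y]
    push_cast
    ring
  have hmain : mainTerm x N = ∑ n ∈ range N, (F (n + 1) - F n)
      - harmonic N / (2 * x) - N * log x - log N.factorial := by
    rw [hF]
    simp only [F, y, mainTerm, Nat.cast_zero, zero_mul, add_zero]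
    ring
  have hdiff : ∑ n ∈ range N, phiR ((n + 1 : ℕ) * x)
      + ∑ n ∈ range N, ∑ m ∈ range N, 1 / ((n + 1 : ℕ) * x + (m + 1 : ℕ)) - mainTerm x N
      = ∑ n ∈ range N, (phiR (y (n + 1)) + 1 / (2 * y (n + 1)) + log (y (n + 1))
        - (F (n + 1) - F n)) := by
    rw [sum_phiR_add_sum_eq hx, hmain, sum_sub_distrib _ fun n => F (n + 1) - F n]
    ring
  rw [hdiff]
  calc _ ≤ ∑ n ∈ range N, C * (1 / y n - 1 / y (n + 1)) := by
        refine (abs_sum_le_sum_abs _ _).trans (sum_le_sum fun n _ => ?_)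
        have hy : 0 < y n := by positivity
        refine le_trans (le_of_eq ?_) ((abs_euler_maclaurin_step_le hx hy).trans_eq ?_)
        · simp only [F, hstep]
          congr 1
          ring
        · rw [hstep]
    _ = C * (1 / y 0 - 1 / y N) := by rw [← mul_sum, hB]
    _ ≤ C * (1 / N) := by
        have : 0 < 1 / y N := by positivity
        refine mul_le_mul_of_nonneg_left ?_ hC0.le
        simp only [y] at this ⊢
        simp only [Nat.cast_zero, zero_mul, add_zero]
        linarith
    _ = C / N := by ring

theorem tendsto_sum_phiR_add_sum_sub_mainTerm {x : ℝ} (hx : 0 < x) :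
    Tendsto (fun N : ℕ => ∑ n ∈ range N, phiR ((n + 1 : ℕ) * x)
      + ∑ n ∈ range N, ∑ m ∈ range N, 1 / ((n + 1 : ℕ) * x + (m + 1 : ℕ)) - mainTerm x N)
      atTop (𝓝 0) := by
  refine squeeze_zero_norm' ?_ (tendsto_const_div_atTop_nhds_zero_nat
    (1 / (2 * x) + x / 4 + 1 / 2))
  filter_upwards [eventually_gt_atTop 0] with N hN
  exact abs_sum_phiR_add_sum_sub_mainTerm_le hx hN

theorem sum_sum_one_div_inv {x : ℝ} (hx : 0 < x) (N : ℕ) :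
    ∑ n ∈ range N, ∑ m ∈ range N, 1 / ((n + 1 : ℕ) * x⁻¹ + (m + 1 : ℕ))
      = x * ∑ n ∈ range N, ∑ m ∈ range N, 1 / ((n + 1 : ℕ) * x + (m + 1 : ℕ)) := by
  rw [sum_comm, mul_sum]
  refine sum_congr rfl fun n _ => ?_
  rw [mul_sum]
  refine sum_congr rfl fun m _ => ?_
  field_simp
  ring

theorem mainTerm_sub_mainTerm_inv {x : ℝ} (hx : 0 < x) {N : ℕ} (hN : 0 < N) :
    mainTerm x N - mainTerm x⁻¹ N / x
      = (1 - 1 / x) * (N * log N - N - log N.factorial + harmonic N / 2)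
        + 1 / 2 * (1 + 1 / x) * log x := by
  have hN' : (0 : ℝ) < N := by exact_mod_cast hN
  have e1 : (N : ℝ) + N * x = N * (1 + x) := by ring
  have e2 : (N : ℝ) + N * x⁻¹ = N * (1 + x) / x := by field_simp; ring
  rw [mainTerm, mainTerm, e1, e2, log_div (by positivity) hx.ne',
    log_mul hN'.ne' (by positivity), log_inv]
  field_simp
  ring

theorem tendsto_log_factorial_harmonic :
    Tendsto (fun N : ℕ => N * log N - N - log N.factorial + (harmonic N : ℝ) / 2) atTop
      (𝓝 ((Real.eulerMascheroniConstant - log (2 * π)) / 2)) := by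
  have h1 := Real.tendsto_harmonic_sub_log
  have h2 := Stirling.tendsto_stirlingSeq_sqrt_pi.log (by positivity)
  have h3 := (h1.div_const 2).sub h2
  have e : (Real.eulerMascheroniConstant - log (2 * π)) / 2
      = Real.eulerMascheroniConstant / 2 - log √π - log 2 / 2 := by
    rw [log_mul two_ne_zero pi_ne_zero, log_sqrt pi_pos.le]
    ring
  rw [e]
  refine (h3.sub_const (log 2 / 2)).congr' ?_
  filter_upwards [eventually_gt_atTop 0] with N hN
  have hN' : (0 : ℝ) < N := by exact_mod_cast hN
  rw [Stirling.log_stirlingSeq_formula, log_mul two_ne_zero hN'.ne',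
    log_div hN'.ne' (exp_pos 1).ne', log_exp]
  ring

theorem tsum_phiR_sub_tsum_phiR_inv {x : ℝ} (hx : 0 < x) :
    ∑' n : ℕ, phiR ((n + 1 : ℕ) * x) - (∑' n : ℕ, phiR ((n + 1 : ℕ) * x⁻¹)) / x
      = (1 - 1 / x) * ((Real.eulerMascheroniConstant - log (2 * π)) / 2)
        + 1 / 2 * (1 + 1 / x) * log x := by
  have hx' : 0 < x⁻¹ := inv_pos.2 hx
  have hleft := (summable_phiR_mul hx).hasSum.tendsto_sum_nat.sub
    ((summable_phiR_mul hx').hasSum.tendsto_sum_nat.div_const x)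
  have hright := ((tendsto_sum_phiR_add_sum_sub_mainTerm hx).sub
    ((tendsto_sum_phiR_add_sum_sub_mainTerm hx').div_const x)).add
      ((tendsto_log_factorial_harmonic.const_mul (1 - 1 / x)).add_const
        (1 / 2 * (1 + 1 / x) * log x))
  rw [zero_div, sub_zero, zero_add] at hright
  refine tendsto_nhds_unique (hleft.congr' ?_) hright
  filter_upwards [eventually_gt_atTop 0] with N hN
  rw [← mainTerm_sub_mainTerm_inv hx hN, sum_sum_one_div_inv hx]
  generalize ∑ n ∈ range N, phiR ((n + 1 : ℕ) * x⁻¹) = S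
  generalize ∑ n ∈ range N, phiR ((n + 1 : ℕ) * x) = S'
  field_simp
  ring

theorem stmt10 (x : ℝ) (hx : 0 < x) :
    Real.sqrt x *
        ((Real.eulerMascheroniConstant - Real.log (2 * Real.pi * x)) / (2 * x)
          + ∑' n : ℕ+, phiR ((n : ℝ) * x))
      = (1 / Real.sqrt x) *
          ((x / 2) * (Real.eulerMascheroniConstant - Real.log (2 * Real.pi / x))
            + ∑' n : ℕ+, phiR ((n : ℝ) / x))
    ∧ Summable (fun n : ℕ+ => phiR ((n : ℝ) * x))
    ∧ Summable (fun n : ℕ+ => phiR ((n : ℝ) / x)) := by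
  have hx' : 0 < x⁻¹ := inv_pos.2 hx
  simp only [div_eq_mul_inv (_ : ℝ) x]
  refine ⟨?_, (summable_pnat_iff_summable_succ (f := fun n : ℕ => phiR (n * x))).2
    (summable_phiR_mul hx), (summable_pnat_iff_summable_succ
      (f := fun n : ℕ => phiR (n * x⁻¹))).2 (summable_phiR_mul hx')⟩
  rw [tsum_pnat_eq_tsum_succ (f := fun n : ℕ => phiR (n * x)),
    tsum_pnat_eq_tsum_succ (f := fun n : ℕ => phiR (n * x⁻¹))]
  have key := tsum_phiR_sub_tsum_phiR_inv hx
  rw [log_mul (by positivity) hx.ne', log_mul (by positivity) hx'.ne', log_inv]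
  have hs : √x ≠ 0 := (Real.sqrt_pos.2 hx).ne'
  rw [sub_eq_iff_eq_add] at key
  rw [key]
  field_simp
  rw [Real.sq_sqrt hx.le]
  field_simp
  ring
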